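/- Let N be a binary network on n leaves with reticulation number r, and let P be a cherry decomposition of N. Then P contains exactly n-1 cherry shapes and exactly r reticulated cherry shapes. -/

import Mathlib

open scoped Classical

noncomputable section

namespace PhyloNet

/-- A directed multigraph on vertex set `ℕ`, given by its multiset of arcs.
Phylogenetic networks are the simple such graphs satisfying `IsNetwork`;
bulged versions are genuinely multigraphs. -/
abbrev Graph := Multiset (ℕ × ℕ)

/-- The vertices of a multigraph: all endpoints of arcs. -/
def verts (M : Graph) : Finset ℕ :=
  M.toFinset.image Prod.fst ∪ M.toFinset.image Prod.snd

/-- Indegree of a vertex (counting parallel arcs with multiplicity). -/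
def indeg (M : Graph) (v : ℕ) : ℕ := Multiset.card (M.filter (fun e => e.2 = v))

/-- Outdegree of a vertex (counting parallel arcs with multiplicity). -/
def outdeg (M : Graph) (v : ℕ) : ℕ := Multiset.card (M.filter (fun e => e.1 = v))

def adj (M : Graph) (u v : ℕ) : Prop := (u, v) ∈ M

/-- A multigraph is acyclic if no vertex reaches itself by a nonempty directed walk. -/
def Acyclic (M : Graph) : Prop := ∀ v : ℕ, ¬ Relation.TransGen (adj M) v v

/-- No parallel arcs. -/
def Simple (M : Graph) : Prop := ∀ e : ℕ × ℕ, M.count e ≤ 1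

/-- The root: the unique vertex of indegree 0 and outdegree 1. -/
def IsRoot (M : Graph) (v : ℕ) : Prop := v ∈ verts M ∧ indeg M v = 0 ∧ outdeg M v = 1

/-- A leaf: a vertex of indegree 1 and outdegree 0. -/
def IsLeaf (M : Graph) (v : ℕ) : Prop := v ∈ verts M ∧ indeg M v = 1 ∧ outdeg M v = 0

/-- A tree vertex: indegree 1 and outdegree at least 2. -/
def IsTreeVertex (M : Graph) (v : ℕ) : Prop := v ∈ verts M ∧ indeg M v = 1 ∧ 2 ≤ outdeg M v

/-- A reticulation: indegree at least 2 and outdegree 1. -/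
def IsRetic (M : Graph) (v : ℕ) : Prop := v ∈ verts M ∧ 2 ≤ indeg M v ∧ outdeg M v = 1

/-- A (phylogenetic) network: a simple DAG with a unique root (indegree 0, outdegree 1),
in which every other vertex is a leaf (indegree 1, outdegree 0), a tree vertex
(indegree 1, outdegree ≥ 2) or a reticulation (indegree ≥ 2, outdegree 1).
The leaves are regarded as labelled by themselves (the label set is the leaf set). -/
def IsNetwork (M : Graph) : Prop :=
  Simple M ∧ Acyclic M ∧ (∃! v, IsRoot M v) ∧
    ∀ v ∈ verts M, IsRoot M v ∨ IsLeaf M v ∨ IsTreeVertex M v ∨ IsRetic M v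

/-- The set of leaves of a multigraph. -/
def leaves (M : Graph) : Finset ℕ :=
  (verts M).filter (fun v => indeg M v = 1 ∧ outdeg M v = 0)

/-- A network is a tree when it has no reticulations. -/
def IsTree (M : Graph) : Prop := IsNetwork M ∧ ∀ v : ℕ, ¬ IsRetic M v

/-- Binary: all vertices have total degree at most 3. -/
def IsBinary (M : Graph) : Prop := ∀ v ∈ verts M, indeg M v + outdeg M v ≤ 3

/-- Semi-binary: all tree vertices have total degree at most 3. -/
def IsSemiBinary (M : Graph) : Prop :=
  ∀ v : ℕ, IsTreeVertex M v → indeg M v + outdeg M v ≤ 3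

/-- The reticulation number: total number of incoming arcs of reticulations minus
the number of reticulations. -/
def reticNumber (M : Graph) : ℕ :=
  ∑ v ∈ (verts M).filter (fun v => 2 ≤ indeg M v), (indeg M v - 1)

/-- The bulged version `B(N)`: replace the outgoing edge of each reticulation of
indegree `k` by `k-1` parallel copies. -/
def bulged (M : Graph) : Graph :=
  M.bind (fun e =>
    Multiset.replicate
      (if 2 ≤ indeg M e.1 ∧ outdeg M e.1 = 1 then indeg M e.1 - 1 else 1) e)

/-- A cherry shape (on distinct vertices `x,y,p` with edges `px, py`) or a
reticulated cherry shape (on distinct vertices `x,y,p_x,p_y` with edges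
`p_x x, p_y p_x, p_y y`, `p_x` a reticulation). -/
inductive Shape : Type where
  | cherry (x y p : ℕ) : Shape
  | retic (x y px py : ℕ) : Shape
deriving DecidableEq

namespace Shape

/-- The edges of a shape. -/
def edges : Shape → Finset (ℕ × ℕ)
  | cherry x y p => {(p, x), (p, y)}
  | retic x y px py => {(px, x), (py, px), (py, y)}

/-- The endpoints of a shape. -/
def endpoints : Shape → Finset ℕ
  | cherry x y _ => {x, y}
  | retic x y _ _ => {x, y}

/-- The internal vertices of a shape. -/
def internals : Shape → Finset ℕ
  | cherry _ _ p => {p}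
  | retic _ _ px py => {px, py}

/-- The middle edge of a reticulated cherry shape. -/
def middleEdge : Shape → Option (ℕ × ℕ)
  | cherry _ _ _ => none
  | retic _ _ px py => some (py, px)

def isCherry : Shape → Bool
  | cherry _ _ _ => true
  | retic _ _ _ _ => false

/-- Validity of a shape as a subgraph of the multigraph `M`: the vertices are
distinct, the edges are present, and the internal reticulation of a reticulated
cherry shape is a reticulation of `M` (indegree ≥ 2 and outdegree ≥ 1). -/
def valid (M : Graph) : Shape → Prop
  | cherry x y p => x ≠ y ∧ x ≠ p ∧ y ≠ p ∧ (p, x) ∈ M ∧ (p, y) ∈ M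
  | retic x y px py =>
      x ≠ y ∧ x ≠ px ∧ x ≠ py ∧ y ≠ px ∧ y ≠ py ∧ px ≠ py ∧
      (px, x) ∈ M ∧ (py, px) ∈ M ∧ (py, y) ∈ M ∧
      2 ≤ indeg M px ∧ 1 ≤ outdeg M px

end Shape

/-- The number of shapes of `P` covering the arc `e`. -/
def covers (P : Finset Shape) (e : ℕ × ℕ) : ℕ :=
  (P.filter (fun A => e ∈ A.edges)).card

/-- A cherry cover of the multigraph `M` with root `r`: a set of valid shapes such
that every arc except the root arc is covered at least once, every outgoing arc of
a reticulation is covered exactly once (so, counted over parallel copies, exactly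
as often as its multiplicity), and every arc covered as the middle edge of a
reticulated cherry shape is covered exactly once. -/
def IsCherryCover (M : Graph) (r : ℕ) (P : Finset Shape) : Prop :=
  (∀ A ∈ P, A.valid M) ∧
  (∀ e ∈ M, e.1 ≠ r → 1 ≤ covers P e) ∧
  (∀ e ∈ M, (2 ≤ indeg M e.1 ∧ 1 ≤ outdeg M e.1) → covers P e = M.count e) ∧
  (∀ e : ℕ × ℕ, (∃ A ∈ P, A.middleEdge = some e) → covers P e = 1)

/-- A cherry decomposition of `M` with root `r`: a set of valid shapes covering
each arc except the root arc exactly once (over parallel copies, exactly as often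
as its multiplicity). -/
def IsCherryDecomp (M : Graph) (r : ℕ) (P : Finset Shape) : Prop :=
  (∀ A ∈ P, A.valid M) ∧
  (∀ e ∈ M, e.1 ≠ r → covers P e = M.count e)

/-- `A` is directly above `B` when an internal vertex of `B` is an endpoint of `A`. -/
def DirectlyAbove (A B : Shape) : Prop := ∃ v ∈ B.internals, v ∈ A.endpoints

/-- `A` is above `B` (within `P`) when some nonempty chain of shapes of `P`, each
directly above the next, leads from `A` to `B`. -/
def Above (P : Finset Shape) : Shape → Shape → Prop :=
  Relation.TransGen (fun A B => A ∈ P ∧ B ∈ P ∧ DirectlyAbove A B)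

/-- A cherry cover is acyclic when no shape is above itself. -/
def AcyclicCover (P : Finset Shape) : Prop := ∀ A : Shape, ¬ Above P A A

/-- A lowest shape of `P`: one that is above no other shape of `P`. -/
def IsLowest (P : Finset Shape) (A : Shape) : Prop :=
  A ∈ P ∧ ∀ B ∈ P, B ≠ A → ¬ Above P A B

/-- `E` is a spanning (directed) tree of `M` rooted at `r`: a subset of the arcs,
on all vertices of `M`, acyclic, in which `r` has indegree 0 and every other
vertex indegree exactly 1. -/
def IsSpanningArborescence (M : Graph) (r : ℕ) (E : Graph) : Prop :=
  E ≤ M ∧ verts E = verts M ∧ Acyclic E ∧ indeg E r = 0 ∧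
    ∀ v ∈ verts E, v ≠ r → indeg E v = 1

/-- `M` has a spanning tree whose leaves are (bijectively labelled by) `L`. -/
def HasSpanningTreeWithLeaves (M : Graph) (L : Finset ℕ) : Prop :=
  ∃ r E, IsRoot M r ∧ IsSpanningArborescence M r E ∧
    ∀ v ∈ verts E, (outdeg E v = 0 ↔ v ∈ L)

/-- A network is tree-based when it has a base tree, i.e. a spanning tree whose
leaves are exactly the (labelled) leaves of the network. -/
def IsTreeBased (M : Graph) : Prop := HasSpanningTreeWithLeaves M (leaves M)

/-- Rename the vertex `a` to `b` in an arc. -/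
def rn (a b : ℕ) (e : ℕ × ℕ) : ℕ × ℕ :=
  (if e.1 = a then b else e.1, if e.2 = a then b else e.2)

/-- The parent of a vertex (an arbitrary in-neighbour; unique for leaves). -/
def parent (M : Graph) (v : ℕ) : ℕ :=
  if h : ∃ p, (p, v) ∈ M then h.choose else 0

/-- `(x,y)` is a cherry: two distinct leaves with a common parent. -/
def IsCherryPair (M : Graph) (x y : ℕ) : Prop :=
  x ≠ y ∧ IsLeaf M x ∧ IsLeaf M y ∧ ∃ p, (p, x) ∈ M ∧ (p, y) ∈ M

/-- `(x,y)` is a reticulated cherry: leaves `x, y` such that the parent of `x` is a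
reticulation that is a child of the parent of `y`. -/
def IsReticCherryPair (M : Graph) (x y : ℕ) : Prop :=
  x ≠ y ∧ IsLeaf M x ∧ IsLeaf M y ∧
    ∃ px py, IsRetic M px ∧ (px, x) ∈ M ∧ (py, px) ∈ M ∧ (py, y) ∈ M

/-- A reducible pair: a cherry or a reticulated cherry. -/
def ReduciblePair (M : Graph) (x y : ℕ) : Prop :=
  IsCherryPair M x y ∨ IsReticCherryPair M x y

/-- Reducing the ordered pair `(x,y)` in the network `M`: delete the edges of the
corresponding cherry shape or reticulated cherry shape, delete isolated vertices,
label unlabelled outdegree-0 vertices by the label of one of their children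
(formally: rename them to that child), and keep the leaf `y` below its parent when
that parent is a multifurcation.  If `(x,y)` is not reducible, do nothing. -/
def reducePair (M : Graph) (xy : ℕ × ℕ) : Graph :=
  let x := xy.1
  let y := xy.2
  if IsCherryPair M x y then
    let p := parent M y
    if outdeg M p = 2 then ((M.erase (p, x)).erase (p, y)).map (rn p y)
    else M.erase (p, x)
  else if IsReticCherryPair M x y then
    let px := parent M x
    let py := parent M y
    let M₁ := M.erase (py, px)
    let M₂ := if indeg M px = 2 then (M₁.erase (px, x)).map (rn px x) else M₁
    if outdeg M py = 2 then (M₂.erase (py, y)).map (rn py y) else M₂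
  else M

/-- Successively reduce the ordered pairs of a sequence. -/
def reduceSeq (M : Graph) : List (ℕ × ℕ) → Graph
  | [] => M
  | e :: S => reduceSeq (reducePair M e) S

/-- Orchard: some sequence of ordered pairs reduces the network to a network on a
single leaf. -/
def IsOrchard (M : Graph) : Prop :=
  ∃ S : List (ℕ × ℕ),
    IsNetwork (reduceSeq M S) ∧ (leaves (reduceSeq M S)).card = 1

/-- One edge contraction: delete an arc and identify its endpoints. -/
def ContractStep (M M' : Graph) : Prop :=
  ∃ e ∈ M, M' = (M.erase e).map (rn e.1 e.2)

/-- `M` can be turned into `M'` by (repeatedly) contracting edges. -/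
def ContractsTo : Graph → Graph → Prop := Relation.ReflTransGen ContractStep

end PhyloNet

namespace PhyloNet

lemma aux_out {N : Graph} (h : N.Nodup) (v : ℕ) :
    outdeg N v = (N.toFinset.filter (fun e => e.1 = v)).card := by
  unfold outdeg
  rw [← Multiset.toFinset_filter, Multiset.toFinset_card_of_nodup (h.filter _)]

lemma aux_in {N : Graph} (h : N.Nodup) (v : ℕ) :
    indeg N v = (N.toFinset.filter (fun e => e.2 = v)).card := by
  unfold indeg
  rw [← Multiset.toFinset_filter, Multiset.toFinset_card_of_nodup (h.filter _)]

lemma aux_two {N : Graph} (h : N.Nodup) {v a b : ℕ} (hab : a ≠ b)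
    (ha : (v, a) ∈ N) (hb : (v, b) ∈ N) : 2 ≤ outdeg N v := by
  rw [aux_out h]
  have hs : ({(v, a), (v, b)} : Finset (ℕ × ℕ)) ⊆ N.toFinset.filter (fun e => e.1 = v) := by
    intro e he
    simp only [Finset.mem_insert, Finset.mem_singleton] at he
    rcases he with rfl | rfl <;> simp [ha, hb]
  have := Finset.card_le_card hs
  rwa [Finset.card_pair (by simp [hab])] at this

lemma aux_two' {N : Graph} (h : N.Nodup) {v a b c : ℕ} (hab : a ≠ b)
    (ha : (v, a) ∈ N) (hb : (v, b) ∈ N) (hd : outdeg N v ≤ 2) (hc : (v, c) ∈ N) :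
    c = a ∨ c = b := by
  rw [aux_out h] at hd
  have hs : ({(v, a), (v, b)} : Finset (ℕ × ℕ)) ⊆ N.toFinset.filter (fun e => e.1 = v) := by
    intro e he
    simp only [Finset.mem_insert, Finset.mem_singleton] at he
    rcases he with rfl | rfl <;> simp [ha, hb]
  have := Finset.eq_of_subset_of_card_le hs (by rwa [Finset.card_pair (by simp [hab])])
  have hm : (v, c) ∈ N.toFinset.filter (fun e => e.1 = v) := by simp [hc]
  rw [← this] at hm
  simpa using hm

lemma aux_one {N : Graph} (h : N.Nodup) {v a b : ℕ}
    (ha : (v, a) ∈ N) (hb : (v, b) ∈ N) (hd : outdeg N v = 1) : a = b := by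
  by_contra hab
  have := aux_two h hab ha hb
  omega

lemma aux_ex {N : Graph} {v : ℕ} (hd : 1 ≤ outdeg N v) : ∃ w, (v, w) ∈ N := by
  unfold outdeg at hd
  obtain ⟨e, he⟩ := Multiset.card_pos_iff_exists_mem.1 hd
  rw [Multiset.mem_filter] at he
  obtain ⟨he, rfl⟩ := he
  exact ⟨e.2, he⟩

lemma aux_v1 {N : Graph} {a b : ℕ} (h : (a, b) ∈ N) : a ∈ verts N := by
  unfold verts
  exact Finset.mem_union_left _ (Finset.mem_image.2 ⟨(a, b), by simpa using h, rfl⟩)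

lemma aux_hand {N : Graph} (h : N.Nodup) :
    ∑ v ∈ verts N, outdeg N v = ∑ v ∈ verts N, indeg N v := by
  have h1 := Finset.card_eq_sum_card_fiberwise (s := N.toFinset) (t := verts N) (f := Prod.fst)
    (by intro e he; exact Finset.mem_union_left _ (Finset.mem_image_of_mem _ he))
  have h2 := Finset.card_eq_sum_card_fiberwise (s := N.toFinset) (t := verts N) (f := Prod.snd)
    (by intro e he; exact Finset.mem_union_right _ (Finset.mem_image_of_mem _ he))
  rw [Finset.sum_congr rfl (fun v _ => aux_out h v), Finset.sum_congr rfl (fun v _ => aux_in h v)]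
  exact h1.symm.trans h2

def auxTop : Shape → ℕ
  | .cherry _ _ p => p
  | .retic _ _ _ py => py

def auxBot : Shape → ℕ
  | .cherry _ _ _ => 0
  | .retic _ _ px _ => px

lemma aux_top {N : Graph} {A : Shape} (hA : A.valid N) :
    ∃ a b, a ≠ b ∧ (auxTop A, a) ∈ N ∧ (auxTop A, b) ∈ N ∧
      (auxTop A, a) ∈ A.edges ∧ (auxTop A, b) ∈ A.edges := by
  cases A with
  | cherry x y p =>
    obtain ⟨h1, h2, h3, h4, h5⟩ := hA
    exact ⟨x, y, h1, h4, h5, by simp [auxTop, Shape.edges], by simp [auxTop, Shape.edges]⟩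
  | retic x y px py =>
    obtain ⟨h1, h2, h3, h4, h5, h6, h7, h8, h9, h10, h11⟩ := hA
    exact ⟨px, y, h4.symm, h8, h9, by simp [auxTop, Shape.edges], by simp [auxTop, Shape.edges]⟩

/-- **Theorem (statement 5).** A cherry decomposition of a binary network with `n`
leaves and reticulation number `r` contains exactly `n - 1` cherry shapes and
exactly `r` reticulated cherry shapes. -/
theorem binary_cherryDecomp_counts (N : Graph) (r : ℕ)
    (hN : IsNetwork N) (hb : IsBinary N) (hr : IsRoot N r)
    (P : Finset Shape) (hP : IsCherryDecomp N r P) :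
    (P.filter (fun A => A.isCherry = true)).card = (leaves N).card - 1 ∧
    (P.filter (fun A => A.isCherry = false)).card = reticNumber N := by
  obtain ⟨hs, -, hu, hc⟩ := hN
  obtain ⟨hv, hcov⟩ := hP
  have hnd : N.Nodup := Multiset.nodup_iff_count_le_one.2 hs
  have hcov1 : ∀ e ∈ N, e.1 ≠ r → (P.filter (fun A => e ∈ A.edges)).card = 1 := by
    intro e he hne
    have := hcov e he hne
    rwa [Multiset.count_eq_one_of_mem hnd he] at this
  have huniq : ∀ e ∈ N, e.1 ≠ r → ∀ A ∈ P, ∀ B ∈ P, e ∈ A.edges → e ∈ B.edges → A = B := by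
    intro e he hne A hA B hB h1 h2
    exact Finset.card_le_one.1 (hcov1 e he hne).le A (by simp [hA, h1]) B (by simp [hB, h2])
  have hex : ∀ e ∈ N, e.1 ≠ r → ∃ A ∈ P, e ∈ A.edges := by
    intro e he hne
    obtain ⟨A, hA⟩ := Finset.card_pos.1 (by rw [hcov1 e he hne]; norm_num :
      0 < (P.filter (fun A => e ∈ A.edges)).card)
    rw [Finset.mem_filter] at hA
    exact ⟨A, hA⟩
  -- classification in the binary case
  have hcl : ∀ v ∈ verts N, v = r ∧ indeg N v = 0 ∧ outdeg N v = 1 ∨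
      v ≠ r ∧ indeg N v = 1 ∧ outdeg N v = 0 ∨ v ≠ r ∧ indeg N v = 1 ∧ outdeg N v = 2 ∨
      v ≠ r ∧ indeg N v = 2 ∧ outdeg N v = 1 := by
    intro v hvv
    have hbv := hb v hvv
    have h0 := hr.2.1
    rcases hc v hvv with h | h | h | h
    · exact Or.inl ⟨hu.unique h hr, h.2⟩
    all_goals
      obtain ⟨-, h1, h2⟩ := h
      have : v ≠ r := by rintro rfl; omega
      omega
  have hT : P.card = ((verts N).filter (fun v => outdeg N v = 2)).card := by
    have htop : ∀ A ∈ P, auxTop A ≠ r ∧ auxTop A ∈ verts N ∧ outdeg N (auxTop A) = 2 := by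
      intro A hA
      obtain ⟨a, b, hab, h1, h2, -, -⟩ := aux_top (hv A hA)
      have h3 := aux_two hnd hab h1 h2
      have h4 := hcl _ (aux_v1 h1)
      refine ⟨?_, aux_v1 h1, ?_⟩ <;> omega
    refine Finset.card_nbij auxTop ?_ ?_ ?_
    · intro A hA
      simp only [Finset.coe_filter, Set.mem_ofPred_eq]
      simpa using (htop A hA).2
    · intro A hA B hB hAB
      obtain ⟨a, b, hab, h1, h2, h3, h4⟩ := aux_top (hv A hA)
      obtain ⟨c, d, hcd, k1, k2, k3, k4⟩ := aux_top (hv B hB)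
      obtain ⟨t1, t2, t3⟩ := htop A hA
      rw [← hAB] at k1 k2 k3 k4
      refine huniq _ h1 t1 A hA B hB h3 ?_
      rcases aux_two' hnd hcd k1 k2 t3.le h1 with rfl | rfl <;> assumption
    · intro v hvv
      simp only [Finset.coe_filter, Set.mem_ofPred_eq] at hvv
      have h4 := hcl v hvv.1
      obtain ⟨w, hw⟩ := aux_ex (N := N) (v := v) (by omega)
      obtain ⟨A, hA, hA'⟩ := hex _ hw (by change v ≠ r; omega)
      refine ⟨A, hA, ?_⟩
      have hvA := hv A hA
      cases A with
      | cherry x y p =>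
        simp [Shape.edges] at hA'
        simp only [auxTop]; omega
      | retic x y px py =>
        obtain ⟨-, -, -, -, -, -, -, -, -, h10, -⟩ := hvA
        simp [Shape.edges] at hA'
        have : v ≠ px := by rintro rfl; omega
        simp only [auxTop]; omega
  have hR : (P.filter (fun A => A.isCherry = false)).card =
      ((verts N).filter (fun v => 2 ≤ indeg N v)).card := by
    refine Finset.card_nbij auxBot ?_ ?_ ?_
    · intro A hA
      obtain ⟨hA, hA'⟩ := Finset.mem_filter.1 (Finset.mem_coe.1 hA)
      have hvA := hv A hA
      cases A with
      | cherry x y p => simp [Shape.isCherry] at hA'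
      | retic x y px py =>
        obtain ⟨-, -, -, -, -, -, h7, -, -, h10, -⟩ := hvA
        exact Finset.mem_coe.2 (Finset.mem_filter.2 ⟨aux_v1 h7, h10⟩)
    · intro A hA B hB hAB
      simp only [Finset.coe_filter, Set.mem_ofPred_eq] at hA hB
      obtain ⟨hA, hA'⟩ := hA
      obtain ⟨hB, hB'⟩ := hB
      have hvA := hv A hA
      have hvB := hv B hB
      cases A with
      | cherry x y p => simp [Shape.isCherry] at hA'
      | retic x y px py =>
      cases B with
      | cherry x y p => simp [Shape.isCherry] at hB'
      | retic x' y' px' py' =>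
        obtain ⟨-, -, -, -, -, -, h7, -, -, h10, -⟩ := hvA
        obtain ⟨-, -, -, -, -, -, k7, -, -, k10, -⟩ := hvB
        simp only [auxBot] at hAB
        subst hAB
        have h4 := hcl _ (aux_v1 h7)
        have := aux_one hnd h7 k7 (by omega)
        subst this
        exact huniq _ h7 (by change px ≠ r; omega) _ hA _ hB (by simp [Shape.edges])
          (by simp [Shape.edges])
    · intro v hvv
      simp only [Finset.coe_filter, Set.mem_ofPred_eq] at hvv
      have h4 := hcl v hvv.1
      obtain ⟨w, hw⟩ := aux_ex (N := N) (v := v) (by omega)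
      obtain ⟨A, hA, hA'⟩ := hex _ hw (by change v ≠ r; omega)
      have hvA := hv A hA
      obtain ⟨a, b, hab, h1, h2, -, -⟩ := aux_top hvA
      have h3 := aux_two hnd hab h1 h2
      have hne : v ≠ auxTop A := by rintro rfl; omega
      cases A with
      | cherry x y p =>
        simp [Shape.edges] at hA'
        simp only [auxTop] at hne; omega
      | retic x y px py =>
        simp [Shape.edges] at hA'
        simp only [auxTop] at hne
        refine ⟨_, ?_, (by simp only [auxBot]; omega : auxBot (.retic x y px py) = v)⟩
        exact Finset.mem_coe.2 (Finset.mem_filter.2 ⟨hA, rfl⟩)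
  have hrn : reticNumber N = ((verts N).filter (fun v => 2 ≤ indeg N v)).card := by
    unfold reticNumber
    rw [Finset.card_eq_sum_ones]
    refine Finset.sum_congr rfl fun v hvv => ?_
    rw [Finset.mem_filter] at hvv
    have := hcl v hvv.1
    omega
  have hsplit : (P.filter (fun A => A.isCherry = true)).card +
      (P.filter (fun A => A.isCherry = false)).card = P.card := by
    rw [← Finset.card_filter_add_card_filter_not (s := P) (fun A => A.isCherry = true)]
    simp
  have hcount : (leaves N).card + ((verts N).filter (fun v => 2 ≤ indeg N v)).card =
      1 + ((verts N).filter (fun v => outdeg N v = 2)).card := by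
    have h1 : (1 : ℕ) = ∑ v ∈ verts N, if v = r then 1 else 0 := by
      rw [Finset.sum_ite_eq' (verts N) r]; simp [hr.1]
    have key : ∑ v ∈ verts N, (outdeg N v + (if indeg N v = 1 ∧ outdeg N v = 0 then 1 else 0)
        + (if 2 ≤ indeg N v then 1 else 0)) = ∑ v ∈ verts N, (indeg N v + (if v = r then 1 else 0)
        + (if outdeg N v = 2 then 1 else 0)) := by
      refine Finset.sum_congr rfl fun v hvv => ?_
      have := hcl v hvv
      split_ifs <;> omega
    simp only [Finset.sum_add_distrib] at key
    rw [aux_hand hnd, ← h1] at key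
    unfold leaves
    simp only [Finset.card_filter]
    omega
  omega

end PhyloNet
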